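/- Let (E,j) be a soft inductive system of Banach spaces over a directed set N, let F̃ be a Banach space, and let ĵ_{∞n} : E_n → F̃ be linear contractions such that lim_n ‖(ĵ_{∞n} ∘ j_{nm} − ĵ_{∞m}) x_m‖ = 0 for every m ∈ N and x_m ∈ E_m. Then for every j-convergent net x_• the limit lim_n ĵ_{∞n} x_n exists in F̃, it vanishes whenever x_• is a null net, and ‖lim_n ĵ_{∞n} x_n‖ ≤ limsup_n ‖x_n‖; hence the induced map from the limit space E_∞ to F̃ is a well-defined linear contraction. -/

import Mathlib

open Filter Topology MeasureTheory

variable {N : Type*} [Preorder N] [IsDirected N (· ≤ ·)] [Nonempty N]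
variable {E : N → Type*} [∀ n, NormedAddCommGroup (E n)] [∀ n, NormedSpace ℂ (E n)]
  [∀ n, CompleteSpace (E n)]

/-- A *soft inductive system* of Banach spaces over the directed set `N`:
linear contractions `j n m : E m → E n` (for `n ≥ m`, with `j n n = id` and
`j n m = 0` when `¬ m ≤ n`), satisfying
`lim_m limsup_n ‖(j n l - j n m ∘ j m l) x‖ = 0` for all `l` and `x : E l`. -/
structure IsSoftInductiveSystem (j : ∀ n m : N, E m →L[ℂ] E n) : Prop where
  map_self : ∀ n, j n n = ContinuousLinearMap.id ℂ (E n)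
  map_not_le : ∀ n m, ¬ m ≤ n → j n m = 0
  contraction : ∀ n m, m ≤ n → ∀ x : E m, ‖j n m x‖ ≤ ‖x‖
  soft : ∀ (l : N) (x : E l),
    Tendsto (fun m => limsup (fun n => ‖j n l x - j n m (j m l x)‖) atTop)
      atTop (𝓝 0)

/-- A net `x = (x n)_{n ∈ N}` (with `x n ∈ E n`) is uniformly bounded. -/
def UniformlyBounded (x : ∀ n, E n) : Prop := ∃ C : ℝ, ∀ n, ‖x n‖ ≤ C

/-- The seminorm `|‖x‖| = limsup_n ‖x n‖` on uniformly bounded nets. -/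
noncomputable def netSeminorm (x : ∀ n, E n) : ℝ := limsup (fun n => ‖x n‖) atTop

/-- The basic net `j_{• m} ξ` associated with `ξ ∈ E m`. -/
def basicNet (j : ∀ n m : N, E m →L[ℂ] E n) (m : N) (ξ : E m) : ∀ n, E n :=
  fun n => j n m ξ

/-- A uniformly bounded net is `j`-convergent if it lies in the seminorm-closure of
the set of basic nets. -/
def JConvergent (j : ∀ n m : N, E m →L[ℂ] E n) (x : ∀ n, E n) : Prop :=
  UniformlyBounded x ∧
    ∀ ε : ℝ, 0 < ε → ∃ (m : N) (ξ : E m), netSeminorm (fun n => x n - j n m ξ) < ε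

/-- A net is a null net if `lim_n ‖x n‖ = 0`. -/
def IsNullNet (x : ∀ n, E n) : Prop := Tendsto (fun n => ‖x n‖) atTop (𝓝 0)

/-- A realization `(G, L)` of the limit space `E_∞ = C(E,j)/C₀(E,j)` of a soft inductive
system: `L` sends a `j`-convergent net to its `j`-limit; it is linear on `j`-convergent
nets, the norm of a `j`-limit is the seminorm of the net, and every element of `G`
arises as a `j`-limit. -/
structure IsLimitSpace (j : ∀ n m : N, E m →L[ℂ] E n) (G : Type*)
    [NormedAddCommGroup G] [NormedSpace ℂ G] (L : (∀ n, E n) → G) : Prop where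
  map_add : ∀ x y, JConvergent j x → JConvergent j y → L (x + y) = L x + L y
  map_smul : ∀ (c : ℂ) (x), JConvergent j x → L (c • x) = c • L x
  norm_eq : ∀ x, JConvergent j x → ‖L x‖ = netSeminorm x
  surjective : ∀ g : G, ∃ x, JConvergent j x ∧ L x = g

theorem IsSoftInductiveSystem.norm_map_le {j : ∀ n m : N, E m →L[ℂ] E n}
    (hj : IsSoftInductiveSystem j) (n m : N) (ξ : E m) : ‖j n m ξ‖ ≤ ‖ξ‖ := by
  by_cases h : m ≤ n
  · exact hj.contraction n m h ξ
  · simp [hj.map_not_le n m h]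

theorem IsSoftInductiveSystem.uniformlyBounded_basicNet {j : ∀ n m : N, E m →L[ℂ] E n}
    (hj : IsSoftInductiveSystem j) (m : N) (ξ : E m) : UniformlyBounded (basicNet j m ξ) :=
  ⟨‖ξ‖, fun n => hj.norm_map_le n m ξ⟩

theorem UniformlyBounded.add {x y : ∀ n, E n} (hx : UniformlyBounded x)
    (hy : UniformlyBounded y) : UniformlyBounded (x + y) := by
  obtain ⟨C, hC⟩ := hx
  obtain ⟨D, hD⟩ := hy
  exact ⟨C + D, fun n => norm_add_le_of_le (hC n) (hD n)⟩

theorem UniformlyBounded.smul {x : ∀ n, E n} (hx : UniformlyBounded x) (c : ℂ) :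
    UniformlyBounded (c • x) := by
  obtain ⟨C, hC⟩ := hx
  refine ⟨‖c‖ * C, fun n => ?_⟩
  rw [Pi.smul_apply, norm_smul]
  exact mul_le_mul_of_nonneg_left (hC n) (norm_nonneg c)

theorem UniformlyBounded.sub {x y : ∀ n, E n} (hx : UniformlyBounded x)
    (hy : UniformlyBounded y) : UniformlyBounded (x - y) := by
  obtain ⟨C, hC⟩ := hx
  obtain ⟨D, hD⟩ := hy
  exact ⟨C + D, fun n => norm_sub_le_of_le (hC n) (hD n)⟩

theorem UniformlyBounded.eventually_norm_lt {x : ∀ n, E n} (hx : UniformlyBounded x) {r : ℝ}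
    (h : netSeminorm x < r) : ∀ᶠ n in atTop, ‖x n‖ < r := by
  obtain ⟨C, hC⟩ := hx
  exact eventually_lt_of_limsup_lt h (isBoundedUnder_of ⟨C, hC⟩)

theorem netSeminorm_le_of_eventually_le {x : ∀ n, E n} {r : ℝ}
    (h : ∀ᶠ n in atTop, ‖x n‖ ≤ r) : netSeminorm x ≤ r :=
  limsup_le_of_le (isCoboundedUnder_le_of_le atTop fun n => norm_nonneg (x n)) h

theorem JConvergent.exists_eventually_norm_sub_lt {j : ∀ n m : N, E m →L[ℂ] E n}
    (hj : IsSoftInductiveSystem j) {x : ∀ n, E n} (hx : JConvergent j x) {ε : ℝ} (hε : 0 < ε) :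
    ∃ (m : N) (ξ : E m), ∀ᶠ n in atTop, ‖x n - j n m ξ‖ < ε := by
  obtain ⟨m, ξ, h⟩ := hx.2 ε hε
  exact ⟨m, ξ, (hx.1.sub (hj.uniformlyBounded_basicNet m ξ)).eventually_norm_lt h⟩

theorem UniformlyBounded.jConvergent {j : ∀ n m : N, E m →L[ℂ] E n} {x : ∀ n, E n}
    (hx : UniformlyBounded x)
    (h : ∀ ε : ℝ, 0 < ε → ∃ (m : N) (ξ : E m), ∀ᶠ n in atTop, ‖x n - j n m ξ‖ < ε) :
    JConvergent j x := by
  refine ⟨hx, fun ε hε => ?_⟩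
  obtain ⟨m, ξ, hξ⟩ := h (ε / 2) (half_pos hε)
  exact ⟨m, ξ, (netSeminorm_le_of_eventually_le (x := fun n => x n - j n m ξ)
    (hξ.mono fun _ => le_of_lt)).trans_lt (half_lt_self hε)⟩

/-- A basic net is approximated by the basic nets it generates at all large indices. -/
theorem IsSoftInductiveSystem.eventually_eventually_norm_sub_lt {j : ∀ n m : N, E m →L[ℂ] E n}
    (hj : IsSoftInductiveSystem j) (l : N) (ξ : E l) {ε : ℝ} (hε : 0 < ε) :
    ∀ᶠ m in atTop, ∀ᶠ n in atTop, ‖j n l ξ - j n m (j m l ξ)‖ < ε := by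
  filter_upwards [(hj.soft l ξ).eventually_lt_const hε] with m hm
  exact ((hj.uniformlyBounded_basicNet l ξ).sub
    (hj.uniformlyBounded_basicNet m (j m l ξ))).eventually_norm_lt hm

theorem JConvergent.add {j : ∀ n m : N, E m →L[ℂ] E n} (hj : IsSoftInductiveSystem j)
    {x y : ∀ n, E n} (hx : JConvergent j x) (hy : JConvergent j y) : JConvergent j (x + y) := by
  refine (hx.1.add hy.1).jConvergent fun ε hε => ?_
  have hε4 : 0 < ε / 4 := by positivity
  obtain ⟨m, ξ, hξ⟩ := hx.exists_eventually_norm_sub_lt hj hε4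
  obtain ⟨l, η, hη⟩ := hy.exists_eventually_norm_sub_lt hj hε4
  obtain ⟨p, hpξ, hpη⟩ := ((hj.eventually_eventually_norm_sub_lt m ξ hε4).and
    (hj.eventually_eventually_norm_sub_lt l η hε4)).exists
  refine ⟨p, j p m ξ + j p l η, ?_⟩
  filter_upwards [hξ, hη, hpξ, hpη] with n h₁ h₂ h₃ h₄
  have hsplit : (x + y) n - j n p (j p m ξ + j p l η) =
      ((x n - j n m ξ) + (y n - j n l η)) +
        ((j n m ξ - j n p (j p m ξ)) + (j n l η - j n p (j p l η))) := by
    rw [Pi.add_apply, _root_.map_add]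
    abel
  rw [hsplit]
  refine (norm_add_le_of_le (norm_add_le _ _) (norm_add_le _ _)).trans_lt ?_
  linarith

theorem JConvergent.smul {j : ∀ n m : N, E m →L[ℂ] E n} (hj : IsSoftInductiveSystem j)
    {x : ∀ n, E n} (hx : JConvergent j x) (c : ℂ) : JConvergent j (c • x) := by
  refine (hx.1.smul c).jConvergent fun ε hε => ?_
  have hc : 0 < ‖c‖ + 1 := by positivity
  obtain ⟨m, ξ, hξ⟩ := hx.exists_eventually_norm_sub_lt hj (div_pos hε hc)
  refine ⟨m, c • ξ, ?_⟩
  filter_upwards [hξ] with n hn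
  rw [Pi.smul_apply, _root_.map_smul, ← smul_sub, norm_smul]
  rw [lt_div_iff₀ hc] at hn
  nlinarith [norm_nonneg (x n - j n m ξ)]

theorem JConvergent.exists_tendsto {j : ∀ n m : N, E m →L[ℂ] E n}
    (hj : IsSoftInductiveSystem j)
    {F : Type*} [NormedAddCommGroup F] [NormedSpace ℂ F] [CompleteSpace F]
    {jh : ∀ n, E n →L[ℂ] F} (hjh : ∀ n (ξ : E n), ‖jh n ξ‖ ≤ ‖ξ‖)
    (hcomp : ∀ (m : N) (ξ : E m),
      Tendsto (fun n => ‖jh n (j n m ξ) - jh m ξ‖) atTop (𝓝 0))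
    {x : ∀ n, E n} (hx : JConvergent j x) :
    ∃ c : F, Tendsto (fun n => jh n (x n)) atTop (𝓝 c) := by
  refine cauchy_map_iff_exists_tendsto.mp (Metric.cauchy_iff.mpr ⟨inferInstance, fun ε hε => ?_⟩)
  have hε4 : 0 < ε / 4 := by positivity
  obtain ⟨m, ξ, hξ⟩ := hx.exists_eventually_norm_sub_lt hj hε4
  refine ⟨Metric.ball (jh m ξ) (ε / 2), ?_, fun a ha b hb => ?_⟩
  · rw [mem_map]
    filter_upwards [hξ, (hcomp m ξ).eventually_lt_const hε4] with n h₁ h₂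
    have h₃ := hjh n (x n - j n m ξ)
    rw [_root_.map_sub] at h₃
    rw [Set.mem_preimage, mem_ball_iff_norm]
    refine (norm_sub_le_norm_sub_add_norm_sub _ (jh n (j n m ξ)) _).trans_lt ?_
    linarith
  · rw [Metric.mem_ball] at ha hb
    linarith [dist_triangle_right a b (jh m ξ)]

theorem UniformlyBounded.norm_le_netSeminorm_of_tendsto
    {F : Type*} [NormedAddCommGroup F] [NormedSpace ℂ F]
    {jh : ∀ n, E n →L[ℂ] F} (hjh : ∀ n (ξ : E n), ‖jh n ξ‖ ≤ ‖ξ‖)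
    {x : ∀ n, E n} (hx : UniformlyBounded x) {c : F}
    (hc : Tendsto (fun n => jh n (x n)) atTop (𝓝 c)) : ‖c‖ ≤ netSeminorm x := by
  refine le_of_forall_gt_imp_ge_of_dense fun r hr => le_of_tendsto hc.norm ?_
  filter_upwards [hx.eventually_norm_lt hr] with n hn
  exact (hjh n (x n)).trans hn.le

/-- Given linear contractions `ĵ_{∞ n} : E n → F̃` with
`lim_n ‖(ĵ_{∞ n} ∘ j n m - ĵ_{∞ m}) ξ‖ = 0` for all `m, ξ`, the limit
`lim_n ĵ_{∞ n} (x n)` exists for every `j`-convergent net `x`, vanishes on null nets,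
and is bounded by the seminorm of `x`; hence the induced map `E_∞ → F̃` is a
well-defined linear contraction. -/
theorem induced_contraction_on_limit (j : ∀ n m : N, E m →L[ℂ] E n)
    (hj : IsSoftInductiveSystem j)
    {F : Type*} [NormedAddCommGroup F] [NormedSpace ℂ F] [CompleteSpace F]
    (jh : ∀ n, E n →L[ℂ] F) (hjh : ∀ n (ξ : E n), ‖jh n ξ‖ ≤ ‖ξ‖)
    (hcomp : ∀ (m : N) (ξ : E m),
      Tendsto (fun n => ‖jh n (j n m ξ) - jh m ξ‖) atTop (𝓝 0))
    {G : Type*} [NormedAddCommGroup G] [NormedSpace ℂ G] [CompleteSpace G]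
    (L : (∀ n, E n) → G) (hL : IsLimitSpace j G L) :
    (∀ x : ∀ n, E n, JConvergent j x →
      ∃ c : F, Tendsto (fun n => jh n (x n)) atTop (𝓝 c)) ∧
    (∀ x : ∀ n, E n, JConvergent j x → IsNullNet x →
      Tendsto (fun n => jh n (x n)) atTop (𝓝 0)) ∧
    (∀ x : ∀ n, E n, JConvergent j x → ∀ c : F,
      Tendsto (fun n => jh n (x n)) atTop (𝓝 c) → ‖c‖ ≤ netSeminorm x) ∧
    ∃ T : G →L[ℂ] F, (∀ g : G, ‖T g‖ ≤ ‖g‖) ∧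
      ∀ x : ∀ n, E n, JConvergent j x →
        Tendsto (fun n => jh n (x n)) atTop (𝓝 (T (L x))) := by
  have hlim : ∀ x, JConvergent j x → ∃ c : F, Tendsto (fun n => jh n (x n)) atTop (𝓝 c) :=
    fun x hx => hx.exists_tendsto hj hjh hcomp
  have hbound : ∀ x, JConvergent j x → ∀ c : F,
      Tendsto (fun n => jh n (x n)) atTop (𝓝 c) → ‖c‖ ≤ netSeminorm x :=
    fun x hx c hc => hx.1.norm_le_netSeminorm_of_tendsto hjh hc
  refine ⟨hlim, fun x _ hnull => squeeze_zero_norm (fun n => hjh n (x n)) hnull, hbound, ?_⟩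
  have huniq : ∀ x y, JConvergent j x → JConvergent j y → L x = L y → ∀ c d : F,
      Tendsto (fun n => jh n (x n)) atTop (𝓝 c) →
      Tendsto (fun n => jh n (y n)) atTop (𝓝 d) → c = d := by
    intro x y hx hy hxy c d hc hd
    have hy' := hy.smul hj (-1)
    have hz := hx.add hj hy'
    have hLz : L (x + (-1 : ℂ) • y) = 0 := by
      rw [hL.map_add _ _ hx hy', hL.map_smul _ _ hy, hxy]
      simp
    have hnorm := hbound _ hz (c - d) ((hc.sub hd).congr fun n => by simp [sub_eq_add_neg])
    rw [← hL.norm_eq _ hz, hLz, norm_zero] at hnorm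
    exact sub_eq_zero.mp (norm_le_zero_iff.mp hnorm)
  choose s hs hLs using hL.surjective
  choose t ht using fun g => hlim (s g) (hs g)
  have htL : ∀ x, JConvergent j x → Tendsto (fun n => jh n (x n)) atTop (𝓝 (t (L x))) := by
    intro x hx
    obtain ⟨c, hc⟩ := hlim x hx
    rwa [huniq (s (L x)) x (hs _) hx (hLs _) _ c (ht _) hc]
  have htnorm : ∀ g, ‖t g‖ ≤ ‖g‖ := fun g => by
    have h := hbound _ (hs g) _ (ht g)
    rwa [← hL.norm_eq _ (hs g), hLs] at h
  let T : G →ₗ[ℂ] F :=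
    { toFun := t
      map_add' := fun g h => by
        refine huniq (s (g + h)) (s g + s h) (hs _) ((hs g).add hj (hs h)) ?_ _ _ (ht _)
          (((ht g).add (ht h)).congr fun n => by simp)
        rw [hL.map_add _ _ (hs g) (hs h), hLs, hLs, hLs]
      map_smul' := fun c g => by
        refine huniq (s (c • g)) (c • s g) (hs _) ((hs g).smul hj c) ?_ _ _ (ht _)
          (((ht g).const_smul c).congr fun n => by simp)
        rw [hL.map_smul _ _ (hs g), hLs, hLs] }
  exact ⟨T.mkContinuous 1 fun g => (htnorm g).trans_eq (one_mul _).symm, htnorm, htL⟩
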